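/- Let p ≥ 2 and q ≥ 1, and let H = K_p^q be the pineapple graph with Laplacian matrix L, apex vertex v**, clique part K (the vertices of K_p, v** ∈ K) and set S of q pendant leaves. Then for every matrix X with L·X·L = L, the quantity r(i,j) = X_{ii} + X_{jj} − X_{ij} − X_{ji} satisfies: r(v**, j) = 2/p for j ∈ K∖{v**}; r(v**, j) = 1 for j ∈ S; r(i,j) = 2/p for distinct i, j ∈ K∖{v**}; r(i,j) = (p+2)/p for i ∈ K∖{v**}, j ∈ S; r(i,j) = 2 for distinct i, j ∈ S. -/

import Mathlib

open Matrix BigOperators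

-- The Laplacian matrix `L = D − A` of a finite simple graph, over `ℝ`.
open Classical in
noncomputable def lapMat {V : Type} [Fintype V] (G : SimpleGraph V) : Matrix V V ℝ :=
  Matrix.of fun i j =>
    if i = j then (Nat.card {v // G.Adj i v} : ℝ)
    else if G.Adj i j then -1 else 0

/-- Vertex set of the pineapple graph `K_p^q`: the apex `v**`, the remaining
`p − 1` clique vertices, and the `q` pendant leaves. -/
abbrev PinV (p' q : ℕ) := Unit ⊕ (Fin p' ⊕ Fin q)

/-- The pineapple graph `K_p^q` (with `p' = p − 1`): the apex `v**` together with the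
`p − 1` other clique vertices induces `K_p`, and each of the `q` pendant leaves is
adjacent only to `v**`. -/
def Pineapple (p' q : ℕ) : SimpleGraph (PinV p' q) :=
  SimpleGraph.fromRel (fun u v =>
    match u, v with
    | Sum.inl _, Sum.inr _ => True                       -- v** – everything
    | Sum.inr _, Sum.inl _ => True
    | Sum.inr (Sum.inl _), Sum.inr (Sum.inl _) => True  -- clique – clique
    | _, _ => False)

open Classical in
theorem lapMat_eq_lapMatrix {V : Type} [Fintype V] (G : SimpleGraph V) :
    lapMat G = G.lapMatrix ℝ := by
  ext i j
  by_cases h : i = j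
  · subst h
    have hcard : Fintype.card {v // G.Adj i v} = G.degree i :=
      G.card_neighborSet_eq_degree i
    simp [lapMat, SimpleGraph.lapMatrix, SimpleGraph.degMatrix, hcard]
  · by_cases hA : G.Adj i j <;>
      simp [lapMat, SimpleGraph.lapMatrix, SimpleGraph.degMatrix, h, hA]

theorem lapMat_isSymm {V : Type} [Fintype V] (G : SimpleGraph V) : (lapMat G).IsSymm := by
  classical
  rw [lapMat_eq_lapMatrix]
  exact G.isSymm_lapMatrix (R := ℝ)

open Classical in
theorem lapMat_mulVec_apply {V : Type} [Fintype V] (G : SimpleGraph V) (y : V → ℝ) (i : V) :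
    (lapMat G *ᵥ y) i = ∑ j, if G.Adj i j then y i - y j else 0 := by
  rw [lapMat_eq_lapMatrix, SimpleGraph.lapMatrix_mulVec_apply, ← Finset.sum_filter,
    Finset.sum_sub_distrib, Finset.sum_const, ← SimpleGraph.neighborFinset_eq_filter,
    SimpleGraph.card_neighborFinset_eq_degree, nsmul_eq_mul]

/-- The resistance between `i` and `j`, read off from a potential `y` that drives a unit current
from `i` to `j`. -/
theorem resistance_eq_potential_sub {V : Type} [Fintype V] [DecidableEq V] {L X : Matrix V V ℝ}
    (hL : L.IsSymm) (hX : L * X * L = L) {i j : V} {y : V → ℝ}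
    (hy : L *ᵥ y = Pi.single i 1 - Pi.single j 1) :
    X i i + X j j - X i j - X j i = y i - y j := by
  have hy' : y ᵥ* L = Pi.single i 1 - Pi.single j 1 := by
    rw [← hy, ← mulVec_transpose, hL.eq]
  have key : (y ᵥ* L) ⬝ᵥ (X *ᵥ (L *ᵥ y)) = y ⬝ᵥ (L *ᵥ y) := by
    rw [← dotProduct_mulVec, mulVec_mulVec, mulVec_mulVec, hX]
  rw [hy, hy'] at key
  simp [mulVec_sub, sub_dotProduct, dotProduct_sub] at key
  linarith

/-- Potentials on the pineapple graph grounded at the apex: `pineapplePotential p' q u` drives a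
unit current from `u` to the apex. -/
noncomputable def pineapplePotential (p' q : ℕ) : PinV p' q → PinV p' q → ℝ
  | Sum.inr (Sum.inl c), Sum.inr (Sum.inl d) => ((if d = c then 1 else 0) + 1) / (p' + 1)
  | Sum.inr (Sum.inr s), Sum.inr (Sum.inr t) => if t = s then 1 else 0
  | _, _ => 0

theorem lapMat_mulVec_pineapplePotential (p' q : ℕ) (u : PinV p' q) :
    lapMat (Pineapple p' q) *ᵥ pineapplePotential p' q u
      = Pi.single u 1 - Pi.single (Sum.inl ()) 1 := by
  have hp : (p' : ℝ) + 1 ≠ 0 := by positivity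
  have hsum : ∀ c : Fin p', ∑ x, ((if x = c then 1 else 0) + 1) / ((p' : ℝ) + 1) = 1 := by
    intro c
    rw [← Finset.sum_div, Finset.sum_add_distrib]
    simp
    field_simp
    ring
  ext w
  rw [lapMat_mulVec_apply]
  rcases u with u | c | s <;> rcases w with w | d | t
  all_goals simp [Pineapple, pineapplePotential, Pi.single_apply]
  · exact hsum c
  · have hdiff : ∀ f : Fin p' → ℝ, ∀ x, (if d = x then 0 else f d - f x) = f d - f x := by
      intro f x
      split_ifs with h <;> simp [h]
    simp only [hdiff fun x => ((if x = c then 1 else 0) + 1) / ((p' : ℝ) + 1)]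
    rw [Finset.sum_sub_distrib, hsum, Finset.sum_const, Finset.card_univ, Fintype.card_fin,
      nsmul_eq_mul]
    field_simp
    ring

theorem resistance_pineapple_eq {p' q : ℕ} {X : Matrix (PinV p' q) (PinV p' q) ℝ}
    (hX : lapMat (Pineapple p' q) * X * lapMat (Pineapple p' q) = lapMat (Pineapple p' q))
    (i j : PinV p' q) :
    X i i + X j j - X i j - X j i =
      pineapplePotential p' q i i - pineapplePotential p' q j i
        - (pineapplePotential p' q i j - pineapplePotential p' q j j) := by
  refine resistance_eq_potential_sub (lapMat_isSymm _) hX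
    (y := pineapplePotential p' q i - pineapplePotential p' q j) ?_
  rw [mulVec_sub, lapMat_mulVec_pineapplePotential, lapMat_mulVec_pineapplePotential,
    sub_sub_sub_cancel_right]

/-- Resistance distances in the pineapple graph `K_p^q` (`p ≥ 2`, `q ≥ 1`). -/
theorem resistance_pineapple (p q : ℕ) (hp : 2 ≤ p) (hq : 1 ≤ q)
    (X : Matrix (PinV (p - 1) q) (PinV (p - 1) q) ℝ)
    (hX : lapMat (Pineapple (p - 1) q) * X * lapMat (Pineapple (p - 1) q)
        = lapMat (Pineapple (p - 1) q)) :
    -- v** and another clique vertex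
    (∀ j : Fin (p - 1),
      X (Sum.inl ()) (Sum.inl ()) + X (Sum.inr (Sum.inl j)) (Sum.inr (Sum.inl j))
        - X (Sum.inl ()) (Sum.inr (Sum.inl j)) - X (Sum.inr (Sum.inl j)) (Sum.inl ())
        = 2 / (p : ℝ)) ∧
    -- v** and a leaf
    (∀ j : Fin q,
      X (Sum.inl ()) (Sum.inl ()) + X (Sum.inr (Sum.inr j)) (Sum.inr (Sum.inr j))
        - X (Sum.inl ()) (Sum.inr (Sum.inr j)) - X (Sum.inr (Sum.inr j)) (Sum.inl ())
        = 1) ∧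
    -- two distinct clique vertices other than v**
    (∀ i j : Fin (p - 1), i ≠ j →
      X (Sum.inr (Sum.inl i)) (Sum.inr (Sum.inl i))
        + X (Sum.inr (Sum.inl j)) (Sum.inr (Sum.inl j))
        - X (Sum.inr (Sum.inl i)) (Sum.inr (Sum.inl j))
        - X (Sum.inr (Sum.inl j)) (Sum.inr (Sum.inl i)) = 2 / (p : ℝ)) ∧
    -- a clique vertex other than v** and a leaf
    (∀ (i : Fin (p - 1)) (j : Fin q),
      X (Sum.inr (Sum.inl i)) (Sum.inr (Sum.inl i))
        + X (Sum.inr (Sum.inr j)) (Sum.inr (Sum.inr j))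
        - X (Sum.inr (Sum.inl i)) (Sum.inr (Sum.inr j))
        - X (Sum.inr (Sum.inr j)) (Sum.inr (Sum.inl i))
        = ((p : ℝ) + 2) / (p : ℝ)) ∧
    -- two distinct leaves
    (∀ i j : Fin q, i ≠ j →
      X (Sum.inr (Sum.inr i)) (Sum.inr (Sum.inr i))
        + X (Sum.inr (Sum.inr j)) (Sum.inr (Sum.inr j))
        - X (Sum.inr (Sum.inr i)) (Sum.inr (Sum.inr j))
        - X (Sum.inr (Sum.inr j)) (Sum.inr (Sum.inr i)) = 2) := by
  have hcast : ((p - 1 : ℕ) : ℝ) + 1 = p := by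
    rw [Nat.cast_sub (by omega)]
    simp
  have hp0 : (p : ℝ) ≠ 0 := by
    have : p ≠ 0 := by omega
    exact_mod_cast this
  refine ⟨fun j => ?_, fun j => ?_, fun i j hij => ?_, fun i j => ?_, fun i j hij => ?_⟩ <;>
    rw [resistance_pineapple_eq hX]
  · simp [pineapplePotential, hcast]
    norm_num
  · simp [pineapplePotential]
  · simp [pineapplePotential, hcast, hij, hij.symm]
    ring
  · simp [pineapplePotential, hcast]
    field_simp
    ring
  · simp [pineapplePotential, hij, hij.symm]
    norm_num
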